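/- arXiv:2203.17201 — 2 statements merged into one kernel-verified Lean document; each statement's English description precedes it below -/
import Mathlib

section
/- Let a and b be coprime positive integers with a > 1, and let m = a/b ∈ ℚ. Then the group G(m) ≤ SL(2,ℚ) generated by A(m) and B(m) is torsion-free: its only element of finite order is the identity matrix. -/
open Matrix Pointwise

abbrev SL2 (R : Type*) [CommRing R] := Matrix.SpecialLinearGroup (Fin 2) R

/-- `A(x) = [[1,x],[0,1]]` as an element of `SL(2,R)`. -/
def Amat {R : Type*} [CommRing R] (x : R) : SL2 R :=
  ⟨!![1, x; 0, 1], by simp [Matrix.det_fin_two_of]⟩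

/-- `B(x) = [[1,0],[x,1]]` as an element of `SL(2,R)`. -/
def Bmat {R : Type*} [CommRing R] (x : R) : SL2 R :=
  ⟨!![1, 0; x, 1], by simp [Matrix.det_fin_two_of]⟩

/-- `G(x)`, the subgroup of `SL(2,R)` generated by `A(x)` and `B(x)`. -/
def Gx {R : Type*} [CommRing R] (x : R) : Subgroup (SL2 R) :=
  Subgroup.closure {Amat x, Bmat x}

/-- The elements of `SL(2,ℚ)` which, up to a power of `b` in the denominators, are congruent to
the identity modulo `a` and have diagonal entries congruent to `1` modulo `a ^ 2`. -/
def DiagCongr (a b : ℕ) (g : SL2 ℚ) : Prop :=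
  ∃ (k : ℕ) (x y z w : ℤ),
    (b : ℚ) ^ k * g 0 0 = (b : ℚ) ^ k + (a : ℚ) ^ 2 * x ∧ (b : ℚ) ^ k * g 0 1 = a * y ∧
    (b : ℚ) ^ k * g 1 0 = a * z ∧ (b : ℚ) ^ k * g 1 1 = (b : ℚ) ^ k + (a : ℚ) ^ 2 * w

lemma DiagCongr.mul {a b : ℕ} {g h : SL2 ℚ} (hg : DiagCongr a b g) (hh : DiagCongr a b h) :
    DiagCongr a b (g * h) := by
  obtain ⟨k, x, y, z, w, h1, h2, h3, h4⟩ := hg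
  obtain ⟨l, x', y', z', w', h1', h2', h3', h4'⟩ := hh
  refine ⟨k + l, b ^ k * x' + b ^ l * x + a ^ 2 * x * x' + y * z',
    (b ^ k + a ^ 2 * x) * y' + y * (b ^ l + a ^ 2 * w'),
    z * (b ^ l + a ^ 2 * x') + (b ^ k + a ^ 2 * w) * z',
    z * y' + b ^ k * w' + b ^ l * w + a ^ 2 * w * w', ?_, ?_, ?_, ?_⟩ <;>
  simp only [Matrix.SpecialLinearGroup.coe_mul, Matrix.mul_apply, Fin.sum_univ_two] <;>
  push_cast
  · linear_combination (b ^ l * h 0 0 : ℚ) * h1 + (b ^ k + a ^ 2 * x : ℚ) * h1' +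
      (b ^ l * h 1 0 : ℚ) * h2 + (a * y : ℚ) * h3'
  · linear_combination (b ^ l * h 0 1 : ℚ) * h1 + (b ^ k + a ^ 2 * x : ℚ) * h2' +
      (b ^ l * h 1 1 : ℚ) * h2 + (a * y : ℚ) * h4'
  · linear_combination (b ^ l * h 0 0 : ℚ) * h3 + (a * z : ℚ) * h1' +
      (b ^ l * h 1 0 : ℚ) * h4 + (b ^ k + a ^ 2 * w : ℚ) * h3'
  · linear_combination (b ^ l * h 0 1 : ℚ) * h3 + (a * z : ℚ) * h2' +
      (b ^ l * h 1 1 : ℚ) * h4 + (b ^ k + a ^ 2 * w : ℚ) * h4'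

lemma DiagCongr.inv {a b : ℕ} {g : SL2 ℚ} (hg : DiagCongr a b g) : DiagCongr a b g⁻¹ := by
  obtain ⟨k, x, y, z, w, h1, h2, h3, h4⟩ := hg
  refine ⟨k, w, -y, -z, x, ?_, ?_, ?_, ?_⟩ <;>
  simp [Matrix.SpecialLinearGroup.coe_inv, Matrix.adjugate_fin_two, *]

lemma diagCongr_of_mem_Gx {a b : ℕ} (hb : 0 < b) {g : SL2 ℚ}
    (hg : g ∈ Gx ((a : ℚ) / (b : ℚ))) : DiagCongr a b g := by
  have hb' : (b : ℚ) ≠ 0 := by positivity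
  induction hg using Subgroup.closure_induction with
  | mem g hg =>
    rcases hg with rfl | rfl
    · exact ⟨1, 0, 1, 0, 0, by simp [Amat], by simp [Amat]; field_simp, by simp [Amat],
        by simp [Amat]⟩
    · exact ⟨1, 0, 0, 1, 0, by simp [Bmat], by simp [Bmat], by simp [Bmat]; field_simp,
        by simp [Bmat]⟩
  | one => exact ⟨0, 0, 0, 0, 0, by simp, by simp, by simp, by simp⟩
  | mul g h _ _ hg hh => exact hg.mul hh
  | inv g _ hg => exact hg.inv

/-- Cayley–Hamilton for `SL(2)`. -/
lemma SL2.sq_eq {R : Type*} [CommRing R] (g : SL2 R) :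
    (g : Matrix (Fin 2) (Fin 2) R) ^ 2 = (g : Matrix (Fin 2) (Fin 2) R).trace • g.1 - 1 := by
  have hd := g.det_coe
  rw [Matrix.det_fin_two] at hd
  ext i j
  fin_cases i <;> fin_cases j <;>
  simp [pow_two, Matrix.mul_apply, Fin.sum_univ_two, Matrix.trace_fin_two] <;>
  grind

lemma SL2.eq_one_of_trace_eq_two {g : SL2 ℚ} (hg : IsOfFinOrder g)
    (ht : (g : Matrix (Fin 2) (Fin 2) ℚ).trace = 2) : g = 1 := by
  obtain ⟨n, hn, hgn⟩ := isOfFinOrder_iff_pow_eq_one.mp hg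
  set M : Matrix (Fin 2) (Fin 2) ℚ := g.1 with hM
  have hsq : M * M = (2 : ℚ) • M - 1 := by rw [← pow_two, ← ht]; exact SL2.sq_eq g
  have hpow : ∀ n : ℕ, M ^ n = 1 + (n : ℚ) • (M - 1) := by
    intro n
    induction n with
    | zero => simp
    | succ n ih =>
      rw [pow_succ, ih, add_mul, smul_mul_assoc, sub_mul, one_mul, hsq]
      push_cast
      module
  have h1 : M ^ n = 1 := by rw [hM, ← Matrix.SpecialLinearGroup.coe_pow, hgn]; rfl
  have h2 : (n : ℚ) • (M - 1) = 0 := by simpa [hpow n] using h1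
  have h3 : M - 1 = 0 := (smul_eq_zero.mp h2).resolve_left (by exact_mod_cast hn.ne')
  exact Subtype.ext (sub_eq_zero.mp h3)

lemma SL2.exists_int_trace {g : SL2 ℚ} (hg : IsOfFinOrder g) :
    ∃ t : ℤ, (g : Matrix (Fin 2) (Fin 2) ℚ).trace = t ∧ |t| ≤ 2 := by
  obtain ⟨n, hn, hgn⟩ := isOfFinOrder_iff_pow_eq_one.mp hg
  set M : Matrix (Fin 2) (Fin 2) ℂ := g.1.map (algebraMap ℚ ℂ) with hM
  have hMn : M ^ n = 1 := by
    have h : g.1 ^ n = 1 := by rw [← Matrix.SpecialLinearGroup.coe_pow, hgn]; rfl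
    have := congrArg (algebraMap ℚ ℂ).mapMatrix h
    simpa [map_pow] using this
  have htr : M.trace = ((g.1.trace : ℚ) : ℂ) := by simp [hM, Matrix.trace_fin_two]
  have hdet : M.det = 1 := by
    have := (algebraMap ℚ ℂ).map_det g.1
    rw [g.det_coe] at this
    simpa using this.symm
  obtain ⟨μ, hμ⟩ := spectrum.nonempty_of_isAlgClosed_of_finiteDimensional ℂ M
  have hpow : μ ^ n = 1 := by
    have h := spectrum.pow_mem_pow M n hμ
    rw [hMn, spectrum.one_eq] at h
    exact h
  have hroot := Matrix.mem_spectrum_iff_isRoot_charpoly.mp hμ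
  rw [Matrix.charpoly_fin_two, hdet, htr] at hroot
  simp only [Polynomial.IsRoot.def, Polynomial.eval_add, Polynomial.eval_sub, Polynomial.eval_mul,
    Polynomial.eval_pow, Polynomial.eval_X, Polynomial.eval_C] at hroot
  have hμ0 : μ ≠ 0 := by
    rintro rfl
    simp at hroot
  have hsum : ((g.1.trace : ℚ) : ℂ) = μ + μ⁻¹ := by
    field_simp
    linear_combination -hroot
  have hint : ∀ z : ℂ, z ^ n = 1 → IsIntegral ℤ z := fun z hz =>
    IsIntegral.of_pow hn (hz ▸ isIntegral_one)
  have hti : IsIntegral ℤ ((g.1.trace : ℚ) : ℂ) :=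
    hsum ▸ (hint μ hpow).add (hint μ⁻¹ (by rw [inv_pow, hpow, inv_one]))
  have hti' : IsIntegral ℤ g.1.trace :=
    (isIntegral_algebraMap_iff (A := ℚ) (B := ℂ) (algebraMap ℚ ℂ).injective).mp hti
  obtain ⟨t, ht⟩ := IsIntegrallyClosed.isIntegral_iff.mp hti'
  have ht' : g.1.trace = t := by simpa using ht.symm
  refine ⟨t, ht', ?_⟩
  have hnorm : ‖μ‖ = 1 := Complex.norm_eq_one_of_pow_eq_one hpow hn.ne'
  have hle : ‖((t : ℤ) : ℂ)‖ ≤ 2 := by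
    have h : ((t : ℤ) : ℂ) = μ + μ⁻¹ := by rw [← hsum, ht']; simp
    rw [h]
    refine (norm_add_le _ _).trans ?_
    rw [norm_inv, hnorm]
    norm_num
  rw [Complex.norm_intCast] at hle
  exact_mod_cast hle

/-- For coprime positive integers `a > 1` and `b`, the group `G(a/b) ≤ SL(2,ℚ)` is
torsion-free: its only element of finite order is the identity. -/
theorem stmt_1 (a b : ℕ) (ha : 1 < a) (hb : 0 < b) (hab : Nat.Coprime a b) :
    ∀ g ∈ Gx ((a : ℚ) / (b : ℚ)), IsOfFinOrder g → g = 1 := by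
  intro g hg hfin
  obtain ⟨t, ht, hbound⟩ := SL2.exists_int_trace hfin
  obtain ⟨k, x, y, z, w, h1, -, -, h4⟩ := diagCongr_of_mem_Gx hb hg
  have hcop : IsCoprime ((a : ℤ) ^ 2) ((b : ℤ) ^ k) := (Nat.isCoprime_iff_coprime.mpr hab).pow
  have hdvd : (a : ℤ) ^ 2 ∣ 2 - t := by
    refine hcop.dvd_of_dvd_mul_left ⟨-(x + w), ?_⟩
    rw [Matrix.trace_fin_two] at ht
    have h : (b : ℚ) ^ k * (2 - t) = a ^ 2 * (-(x + w)) := by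
      linear_combination (b : ℚ) ^ k * ht - h1 - h4
    exact_mod_cast h
  have ha4 : (4 : ℤ) ≤ (a : ℤ) ^ 2 := by
    have : (2 : ℤ) ≤ a := by exact_mod_cast ha
    nlinarith
  obtain ⟨hlo, hhi⟩ := abs_le.mp hbound
  obtain rfl | hlt := hhi.eq_or_lt
  · exact SL2.eq_one_of_trace_eq_two hfin (by simpa using ht)
  have htm : t = -2 := by
    have := Int.le_of_dvd (by omega) hdvd
    omega
  subst htm
  exfalso
  have hsq := SL2.sq_eq g
  rw [ht] at hsq
  have hg2 : g ^ 2 = 1 := by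
    refine SL2.eq_one_of_trace_eq_two hfin.pow ?_
    rw [Matrix.SpecialLinearGroup.coe_pow, hsq, Matrix.trace_sub, Matrix.trace_smul, ht]
    norm_num [Matrix.trace_one]
  have h00 : g 0 0 = -1 := by
    rw [← Matrix.SpecialLinearGroup.coe_pow, hg2] at hsq
    have := congrFun (congrFun hsq 0) 0
    simp at this
    linarith
  have hdvd2 : (a : ℤ) ^ 2 ∣ 2 := by
    refine hcop.dvd_of_dvd_mul_left ⟨-x, ?_⟩
    have h : (b : ℚ) ^ k * 2 = a ^ 2 * (-x) := by
      rw [h00] at h1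
      linear_combination -h1
    exact_mod_cast h
  have := Int.le_of_dvd (by norm_num) hdvd2
  omega
end

section
/- Let p be a prime and e ≥ 1 an integer. Then every proper normal subgroup of SL(2, ℤ/p^eℤ) has index divisible by p. -/
open Matrix Pointwise

section Elementary

variable {R : Type*} [CommRing R]

lemma coe_Amat (x : R) : (Amat x : Matrix (Fin 2) (Fin 2) R) = !![1, x; 0, 1] := rfl

lemma coe_Bmat (x : R) : (Bmat x : Matrix (Fin 2) (Fin 2) R) = !![1, 0; x, 1] := rfl

lemma Amat_zero : Amat (0 : R) = 1 := by
  ext i j; fin_cases i <;> fin_cases j <;> simp [coe_Amat]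

lemma Bmat_zero : Bmat (0 : R) = 1 := by
  ext i j; fin_cases i <;> fin_cases j <;> simp [coe_Bmat]

lemma Amat_pow (x : R) (n : ℕ) : Amat x ^ n = Amat (n * x) := by
  induction n with
  | zero => rw [pow_zero, Nat.cast_zero, zero_mul, Amat_zero]
  | succ k ih =>
    rw [pow_succ, ih]
    ext i j
    fin_cases i <;> fin_cases j <;> simp [coe_Amat, Matrix.mul_apply, Fin.sum_univ_two]
    ring

lemma Bmat_pow (x : R) (n : ℕ) : Bmat x ^ n = Bmat (n * x) := by
  induction n with
  | zero => rw [pow_zero, Nat.cast_zero, zero_mul, Bmat_zero]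
  | succ k ih =>
    rw [pow_succ, ih]
    ext i j
    fin_cases i <;> fin_cases j <;> simp [coe_Bmat, Matrix.mul_apply, Fin.sum_univ_two]
    ring

/-- A matrix of determinant one whose lower left entry is a unit `c` with inverse `u` is a product
of three elementary matrices. -/
lemma eq_Amat_mul_Bmat_mul_Amat (g : SL2 R) (u : R) (hu : g 1 0 * u = 1) :
    g = Amat ((g 0 0 - 1) * u) * Bmat (g 1 0) * Amat ((g 1 1 - 1) * u) := by
  have hdet := g.det_coe
  rw [Matrix.det_fin_two] at hdet
  ext i j
  fin_cases i <;> fin_cases j <;> simp [coe_Amat, coe_Bmat, Matrix.mul_apply, Fin.sum_univ_two]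
  · linear_combination (1 - g 0 0) * hu
  · linear_combination (-g 0 1 - (g 0 0 - 1) * (g 1 1 - 1) * u) * hu - u * hdet
  · linear_combination (1 - g 1 1) * hu

/-- Over a local ring, the elementary matrices generate `SL(2,R)`. -/
lemma eq_top_of_Amat_mem_of_Bmat_mem [IsLocalRing R] (H : Subgroup (SL2 R))
    (hA : ∀ x, Amat x ∈ H) (hB : ∀ x, Bmat x ∈ H) : H = ⊤ := by
  have of_isUnit : ∀ g : SL2 R, IsUnit (g 1 0) → g ∈ H := fun g hg ↦ by
    obtain ⟨u, hu⟩ := hg.exists_right_inv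
    rw [eq_Amat_mul_Bmat_mul_Amat g u hu]
    exact H.mul_mem (H.mul_mem (hA _) (hB _)) (hA _)
  refine (Subgroup.eq_top_iff' H).2 fun g ↦ ?_
  by_cases hc : IsUnit (g 1 0)
  · exact of_isUnit g hc
  have hdet := g.det_coe
  rw [Matrix.det_fin_two] at hdet
  have ha : IsUnit (g 0 0) := by
    by_contra ha
    refine (IsLocalRing.mem_maximalIdeal (1 : R)).1 ?_ isUnit_one
    rw [← hdet]
    exact Ideal.sub_mem _ (Ideal.mul_mem_right _ _ ha) (Ideal.mul_mem_left _ _ hc)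
  have hac : IsUnit (g 0 0 + g 1 0) := by
    by_contra hac
    have : g 0 0 + g 1 0 - g 1 0 ∈ IsLocalRing.maximalIdeal R := Ideal.sub_mem _ hac hc
    rw [add_sub_cancel_right] at this
    exact this ha
  refine (H.mul_mem_cancel_left (hB 1)).1 (of_isUnit _ ?_)
  simpa [coe_Bmat, Matrix.mul_apply, Fin.sum_univ_two] using hac

end Elementary

lemma ZMod.isLocalRing_prime_pow (p : ℕ) (hp : p.Prime) (e : ℕ) (he : 1 ≤ e) :
    IsLocalRing (ZMod (p ^ e)) := by
  have : Fact (1 < p ^ e) := ⟨Nat.one_lt_pow (by omega) hp.one_lt⟩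
  have : NeZero (p ^ e) := ⟨(pow_pos hp.pos e).ne'⟩
  have key : ∀ a : ZMod (p ^ e), ¬ IsUnit a → IsNilpotent a := fun a ha ↦ by
    rw [← ZMod.natCast_zmod_val a, ZMod.isUnit_iff_coprime,
      Nat.coprime_pow_right_iff (by omega), Nat.coprime_comm, hp.coprime_iff_not_dvd,
      not_not] at ha
    refine ⟨e, ?_⟩
    rw [← ZMod.natCast_zmod_val a, ← Nat.cast_pow, ZMod.natCast_eq_zero_iff]
    exact pow_dvd_pow_of_dvd ha e
  refine IsLocalRing.of_isUnit_or_isUnit_one_sub_self fun a ↦ ?_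
  by_cases ha : IsUnit a
  · exact .inl ha
  · exact .inr (key a ha).isUnit_one_sub

/-- If the index of a normal subgroup is coprime to `n`, the subgroup contains every element
whose order divides `n`. -/
lemma Subgroup.mem_of_pow_eq_one_of_coprime_index {G : Type*} [Group G] (N : Subgroup G)
    [N.Normal] {n : ℕ} (hn : n.Coprime N.index) {g : G} (hg : g ^ n = 1) : g ∈ N := by
  rw [← QuotientGroup.eq_one_iff (N := N), ← orderOf_eq_one_iff]
  refine Nat.eq_one_of_dvd_coprimes hn (orderOf_dvd_of_pow_eq_one ?_) ?_
  · rw [← QuotientGroup.mk_pow, hg, QuotientGroup.mk_one]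
  · exact _root_.orderOf_dvd_natCard _

/-- Every proper normal subgroup of `SL(2, ℤ/p^eℤ)` has index divisible by `p`. -/
theorem stmt_9 (p : ℕ) (hp : p.Prime) (e : ℕ) (he : 1 ≤ e)
    (N : Subgroup (SL2 (ZMod (p ^ e)))) (hN : N.Normal) (hNtop : N ≠ ⊤) :
    p ∣ N.index := by
  by_contra hdvd
  have hcop : (p ^ e).Coprime N.index := (hp.coprime_iff_not_dvd.2 hdvd).pow_left e
  have := ZMod.isLocalRing_prime_pow p hp e he
  refine hNtop (eq_top_of_Amat_mem_of_Bmat_mem N (fun x ↦ ?_) fun x ↦ ?_)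
  · refine N.mem_of_pow_eq_one_of_coprime_index hcop ?_
    rw [Amat_pow, ZMod.natCast_self, zero_mul, Amat_zero]
  · refine N.mem_of_pow_eq_one_of_coprime_index hcop ?_
    rw [Bmat_pow, ZMod.natCast_self, zero_mul, Bmat_zero]
end
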